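/- arXiv:1203.6738 — 2 statements merged into one kernel-verified Lean document; each statement's English description precedes it below -/
import Mathlib

section
/- For every n ≥ 1 there is a constant C depending only on n such that for all reals 1 ≤ M ≤ N and every set R in the class 𝓡_M(N), the cardinality of R is at most C · M · N^{n−1}. -/
open Finset

/-- `R ∈ 𝓡_M(N)`: `R` is the intersection of the lattice points of a cube of side length `2N`
(centered at a lattice point `ξ₀`) with a strip `{ξ : |a·ξ − A| ≤ M}` of width `2M`. -/
def InStripClass (n : ℕ) (M N : ℝ) (R : Set (Fin n → ℤ)) : Prop :=
  ∃ (ξ₀ : Fin n → ℤ) (v : Fin n → ℝ) (A : ℝ),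
    (∑ i, v i ^ 2) = 1 ∧
    R = {ξ | (∀ i, |(ξ i : ℝ) - (ξ₀ i : ℝ)| ≤ N) ∧ |(∑ i, v i * (ξ i : ℝ)) - A| ≤ M}

/-- A vector with Euclidean norm `1` has a coordinate that is bounded below in absolute value by
the inverse of the dimension. -/
lemma exists_one_le_card_mul_abs_of_sum_sq_eq_one {m : ℕ} {v : Fin (m + 1) → ℝ}
    (hv : ∑ i, v i ^ 2 = 1) : ∃ i, 1 ≤ (m + 1 : ℝ) * |v i| := by
  by_contra! h
  have hm : (0 : ℝ) < m + 1 := by positivity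
  have hlt : ∀ i, (m + 1 : ℝ) * v i ^ 2 < 1 := fun i => by
    have h1 := h i
    have h0 := abs_nonneg (v i)
    have hle : |v i| ≤ 1 := by nlinarith
    rw [← sq_abs]
    nlinarith
  have hsum : ∑ i : Fin (m + 1), (m + 1 : ℝ) * v i ^ 2 < ∑ _i : Fin (m + 1), (1 : ℝ) :=
    Finset.sum_lt_sum_of_nonempty Finset.univ_nonempty fun i _ => hlt i
  rw [← Finset.mul_sum, hv] at hsum
  simp at hsum

/-- Two points of a strip of width `2M` on a common line in the direction of the `i`-th axis have
`i`-th coordinates at distance at most `2M / |v i|`. -/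
lemma abs_mul_abs_sub_le_of_strip {m : ℕ} {v x y : Fin (m + 1) → ℝ} {A M : ℝ} {i : Fin (m + 1)}
    (hx : |∑ j, v j * x j - A| ≤ M) (hy : |∑ j, v j * y j - A| ≤ M)
    (hxy : ∀ j, x (i.succAbove j) = y (i.succAbove j)) :
    |v i| * |x i - y i| ≤ 2 * M := by
  rw [Fin.sum_univ_succAbove _ i] at hx hy
  simp only [hxy] at hx
  rw [← abs_mul]
  rw [abs_le] at *
  constructor <;> linarith [hx.1, hx.2, hy.1, hy.2]

/-- a strip of width `2M` in a cube of side `2N` contains at most `C·M·N^{n−1}`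
lattice points. -/
theorem card_strip_le (n : ℕ) (hn : 1 ≤ n) :
    ∃ C > 0, ∀ M N : ℝ, 1 ≤ M → M ≤ N → ∀ R : Set (Fin n → ℤ),
      InStripClass n M N R →
      R.Finite ∧ (Nat.card R : ℝ) ≤ C * M * N ^ (n - 1) := by
  classical
  obtain ⟨m, rfl⟩ : ∃ m, n = m + 1 := ⟨n - 1, by omega⟩
  refine ⟨5 * (m + 1) * 3 ^ m, by positivity, ?_⟩
  rintro M N hM hMN R ⟨ξ₀, v, A, hv, rfl⟩
  obtain ⟨i, hi⟩ := exists_one_le_card_mul_abs_of_sum_sq_eq_one hv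
  have hN : 0 ≤ N := by linarith
  set L := ⌊N⌋₊
  set K := ⌊2 * M * (m + 1)⌋₊
  have hL : (L : ℝ) ≤ N := Nat.floor_le hN
  have hK : (K : ℝ) ≤ 2 * M * (m + 1) := Nat.floor_le (by positivity)
  have mem_Icc_of_abs : ∀ {a b : ℤ} {r : ℝ}, |(a : ℝ) - b| ≤ r →
      a ∈ Finset.Icc (b - ⌊r⌋₊) (b + ⌊r⌋₊) := fun {a b r} h => by
    have h1 : (a - b).natAbs ≤ ⌊r⌋₊ := Nat.le_floor (by
      rw [Nat.cast_natAbs]; push_cast; exact h)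
    rw [Finset.mem_Icc]
    omega
  have card_Icc : ∀ (b : ℤ) (k : ℕ), #(Finset.Icc (b - k) (b + k)) = 2 * k + 1 := fun b k => by
    rw [Int.card_Icc]
    omega
  set R : Set (Fin (m + 1) → ℤ) := {ξ | (∀ i, |(ξ i : ℝ) - (ξ₀ i : ℝ)| ≤ N) ∧
    |(∑ i, v i * (ξ i : ℝ)) - A| ≤ M}
  have hfin : R.Finite :=
    (Finset.finite_toSet (Fintype.piFinset fun j => Finset.Icc (ξ₀ j - L) (ξ₀ j + L))).subset
      fun ξ hξ => Fintype.mem_piFinset.2 fun j => mem_Icc_of_abs (hξ.1 j)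
  refine ⟨hfin, ?_⟩
  have himage : #(hfin.toFinset.image i.removeNth) ≤ (2 * L + 1) ^ m := by
    calc #(hfin.toFinset.image i.removeNth)
        ≤ #(Fintype.piFinset fun j : Fin m =>
            Finset.Icc (ξ₀ (i.succAbove j) - L) (ξ₀ (i.succAbove j) + L)) := by
          refine Finset.card_le_card (Finset.image_subset_iff.2 fun ξ hξ => ?_)
          exact Fintype.mem_piFinset.2 fun j =>
            mem_Icc_of_abs ((hfin.mem_toFinset.1 hξ).1 (i.succAbove j))
      _ = (2 * L + 1) ^ m := by simp only [Fintype.card_piFinset, card_Icc]; simp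
  have hfiber : ∀ a ∈ hfin.toFinset.image i.removeNth,
      #{ξ ∈ hfin.toFinset | i.removeNth ξ = a} ≤ 2 * K + 1 := by
    intro a ha
    obtain ⟨y, hy, rfl⟩ := Finset.mem_image.1 ha
    rw [← card_Icc (y i) K]
    refine Finset.card_le_card_of_injOn (fun ξ => ξ i) (fun ξ hξ => ?_) fun ξ hξ η hη h => ?_
    · obtain ⟨hξR, hξy⟩ := Finset.mem_filter.1 hξ
      have hdist := abs_mul_abs_sub_le_of_strip (i := i) (x := fun j => (ξ j : ℝ))
        (y := fun j => (y j : ℝ)) (hfin.mem_toFinset.1 hξR).2 (hfin.mem_toFinset.1 hy).2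
        fun j => congrArg Int.cast (congrFun hξy j)
      refine mem_Icc_of_abs ?_
      calc |(ξ i : ℝ) - y i| ≤ (m + 1) * |v i| * |(ξ i : ℝ) - y i| :=
            le_mul_of_one_le_left (abs_nonneg _) hi
        _ = (m + 1) * (|v i| * |(ξ i : ℝ) - y i|) := by ring
        _ ≤ (m + 1) * (2 * M) := by gcongr
        _ = 2 * M * (m + 1) := by ring
    · rw [← i.insertNth_self_removeNth ξ, ← i.insertNth_self_removeNth η,
        (Finset.mem_filter.1 hξ).2, (Finset.mem_filter.1 hη).2]
      exact congrArg (fun t => i.insertNth t _) h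
  have hcard : Nat.card R ≤ (2 * K + 1) * (2 * L + 1) ^ m := by
    rw [Nat.card_coe_set_eq, Set.ncard_eq_toFinset_card R hfin]
    exact (Finset.card_le_mul_card_image _ _ hfiber).trans (Nat.mul_le_mul_left _ himage)
  have hm : (0 : ℝ) ≤ m := m.cast_nonneg
  calc (Nat.card R : ℝ) ≤ (2 * K + 1) * (2 * L + 1) ^ m := by exact_mod_cast hcard
    _ ≤ (5 * (m + 1) * M) * (3 * N) ^ m := by
        gcongr
        · nlinarith
        · linarith
    _ = 5 * (m + 1) * 3 ^ m * M * N ^ (m + 1 - 1) := by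
        rw [mul_pow, Nat.add_sub_cancel]; ring
end

section
/- (Bilinear estimate without decay, n ≥ 5.) Let n ≥ 5. Then there exists C > 0 such that for every real N ≥ 1, every ξ₀ ∈ ℤⁿ, every finitely supported a₁ : ℤⁿ → ℂ with supp a₁ ⊆ ξ₀ + [−N,N]ⁿ, and every finitely supported a₂ : ℤⁿ → ℂ with supp a₂ ⊆ {ξ : |ξ| ≤ 2N}, the free Schrödinger waves satisfy ‖u_{a₁} u_{a₂}‖_{L²([0,2π]×[0,2π]ⁿ)} ≤ C · N^{n/2 − 1} · ‖a₁‖_{ℓ²} ‖a₂‖_{ℓ²}. -/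
open MeasureTheory Real Finset

noncomputable section

/-- The free Schrödinger wave `u_a(t,x) = Σ_ξ a(ξ) e^{i(x·ξ − t|ξ|²)}` on the torus. -/
def tWave (n : ℕ) (a : (Fin n → ℤ) →₀ ℂ) (t : ℝ) (x : Fin n → ℝ) : ℂ :=
  ∑ ξ ∈ a.support, a ξ *
    Complex.exp (Complex.I *
      (((∑ i, x i * (ξ i : ℝ)) - t * ∑ i, ((ξ i : ℝ)) ^ 2 : ℝ) : ℂ))

/-- The ℓ² norm of the Fourier coefficients. -/
def l2Norm (n : ℕ) (a : (Fin n → ℤ) →₀ ℂ) : ℝ :=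
  Real.sqrt (∑ ξ ∈ a.support, ‖a ξ‖ ^ 2)

/-- Euclidean norm of a lattice point in `ℤⁿ`. -/
def znorm (n : ℕ) (ξ : Fin n → ℤ) : ℝ :=
  Real.sqrt (∑ i, ((ξ i : ℝ)) ^ 2)

/-- The period box `[0,2π] × [0,2π]ⁿ`. -/
def stBox (n : ℕ) : Set (ℝ × (Fin n → ℝ)) :=
  Set.Icc 0 (2 * π) ×ˢ Set.univ.pi fun _ => Set.Icc 0 (2 * π)

/-- The `L^p` norm over the period box `[0,2π] × [0,2π]ⁿ`. -/
def boxLpNorm (n : ℕ) (p : ℝ) (f : ℝ → (Fin n → ℝ) → ℂ) : ℝ :=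
  (∫ q in stBox n, ‖f q.1 q.2‖ ^ p) ^ (1 / p)

end

/-- Van der Corput differencing for a finite sum. -/
theorem norm_sum_range_sq_eq (f : ℕ → ℂ) (M : ℕ) :
    ‖∑ h ∈ range M, f h‖ ^ 2 = ∑ h ∈ range M, ‖f h‖ ^ 2 +
      2 * (∑ d ∈ range M, ∑ h ∈ range (M - (d + 1)),
        f (h + (d + 1)) * (starRingEnd ℂ) (f h)).re := by
  induction M with
  | zero => simp
  | succ M ih =>
    have hstep : ∑ d ∈ range (M + 1), ∑ h ∈ range (M + 1 - (d + 1)),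
          f (h + (d + 1)) * (starRingEnd ℂ) (f h) =
        ∑ d ∈ range M, ∑ h ∈ range (M - (d + 1)), f (h + (d + 1)) * (starRingEnd ℂ) (f h) +
          f M * (starRingEnd ℂ) (∑ h ∈ range M, f h) := by
      rw [sum_range_succ, map_sum, mul_sum,
        ← sum_range_reflect (fun h => f M * (starRingEnd ℂ) (f h)), ← sum_add_distrib]
      simp only [Nat.sub_self, range_zero, sum_empty, add_zero]
      refine sum_congr rfl fun d hd => ?_
      have hd' := mem_range.1 hd
      rw [show M + 1 - (d + 1) = M - (d + 1) + 1 by omega, sum_range_succ,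
        show M - (d + 1) + (d + 1) = M by omega, show M - 1 - d = M - (d + 1) by omega]
    have hre : (∑ h ∈ range M, f h) * (starRingEnd ℂ) (f M) =
        (starRingEnd ℂ) (f M * (starRingEnd ℂ) (∑ h ∈ range M, f h)) := by
      rw [map_mul, Complex.conj_conj, mul_comm]
    rw [hstep, sum_range_succ, sum_range_succ, Complex.add_re, ← Complex.normSq_eq_norm_sq,
      Complex.normSq_add, Complex.normSq_eq_norm_sq, Complex.normSq_eq_norm_sq, ih, hre,
      Complex.conj_re]
    ring

theorem norm_geom_sum_exp_mul_le (θ : ℝ) (m : ℕ) :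
    ∃ k : ℤ, ‖∑ h ∈ range m, Complex.exp ((θ * h : ℝ) * Complex.I)‖ * |θ / (2 * π) - k| ≤ 1 := by
  refine ⟨round (θ / (2 * π)), ?_⟩
  set k := round (θ / (2 * π))
  set y := θ / (2 * π) - k with hy
  have hy2 : |y| ≤ 1 / 2 := abs_sub_round _
  set z := Complex.exp (θ * Complex.I) with hz
  have hsum : ∑ h ∈ range m, Complex.exp ((θ * h : ℝ) * Complex.I) = ∑ h ∈ range m, z ^ h := by
    refine sum_congr rfl fun h _ => ?_
    rw [hz, ← Complex.exp_nat_mul]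
    push_cast
    ring_nf
  have hz1 : z = Complex.exp (Complex.I * (2 * π * y : ℝ)) := by
    have : Complex.I * (2 * π * y : ℝ) = θ * Complex.I + (-k : ℤ) * (2 * π * Complex.I) := by
      have : (2 * π * y : ℝ) = θ - 2 * π * k := by
        rw [hy]; field_simp
      rw [this]; push_cast; ring
    rw [this, Complex.exp_add, Complex.exp_int_mul_two_pi_mul_I, mul_one]
  have hlow : 4 * |y| ≤ ‖z - 1‖ := by
    rw [hz1, Complex.norm_exp_I_mul_ofReal_sub_one, show 2 * π * y / 2 = π * y by ring, norm_mul,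
      Real.norm_eq_abs, Real.norm_eq_abs]
    have h1 : |π * y| = π * |y| := by rw [abs_mul, abs_of_pos pi_pos]
    have := Real.mul_abs_le_abs_sin (x := π * y) (by rw [h1]; nlinarith [pi_pos])
    rw [h1] at this
    have h2 : 2 / π * (π * |y|) = 2 * |y| := by field_simp
    rw [h2] at this
    rw [abs_two]; linarith
  have hup : ‖∑ h ∈ range m, z ^ h‖ * ‖z - 1‖ ≤ 2 := by
    rw [← norm_mul, geom_sum_mul]
    refine (norm_sub_le _ _).trans ?_
    rw [norm_pow, hz, Complex.norm_exp_ofReal_mul_I]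
    norm_num
  rw [hsum]
  nlinarith [norm_nonneg (∑ h ∈ range m, z ^ h)]

theorem norm_weyl_sum_sq_le (t b c : ℝ) (M : ℕ) :
    ‖∑ h ∈ range M, Complex.exp ((t * (2 * h ^ 2 + b * h + c) : ℝ) * Complex.I)‖ ^ 2 ≤ M +
      2 * ∑ d ∈ range M, ‖∑ h ∈ range (M - (d + 1)),
        Complex.exp ((4 * t * ((d + 1 : ℕ) : ℝ) * h : ℝ) * Complex.I)‖ := by
  rw [norm_sum_range_sq_eq]
  simp only [Complex.norm_exp_ofReal_mul_I, one_pow, sum_const, card_range, nsmul_eq_mul, mul_one]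
  gcongr
  refine (Complex.re_le_norm _).trans ((norm_sum_le _ _).trans (sum_le_sum fun d _ => ?_))
  have : ∀ h : ℕ, Complex.exp ((t * (2 * (h + (d + 1) : ℕ) ^ 2 + b * (h + (d + 1) : ℕ) + c) : ℝ) *
        Complex.I) * (starRingEnd ℂ)
          (Complex.exp ((t * (2 * h ^ 2 + b * h + c) : ℝ) * Complex.I)) =
      Complex.exp ((t * (2 * (d + 1) ^ 2 + b * (d + 1)) : ℝ) * Complex.I) *
        Complex.exp ((4 * t * ((d + 1 : ℕ) : ℝ) * h : ℝ) * Complex.I) := by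
    intro h
    rw [← Complex.exp_conj, ← Complex.exp_add, ← Complex.exp_add, map_mul, Complex.conj_I,
      Complex.conj_ofReal]
    congr 1
    push_cast
    ring
  rw [sum_congr rfl fun h _ => this h, ← mul_sum, norm_mul, Complex.norm_exp_ofReal_mul_I, one_mul]

theorem sum_Icc_rpow_neg_le (K : ℕ) :
    ∑ k ∈ Icc 1 K, (k : ℝ) ^ (-(4 / 5) : ℝ) ≤ 5 * (K : ℝ) ^ (1 / 5 : ℝ) := by
  induction K with
  | zero => simp
  | succ K ih =>
    rw [sum_Icc_succ_top (by omega)]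
    set s := ((K + 1 : ℕ) : ℝ) ^ (1 / 5 : ℝ) with hs
    set r := (K : ℝ) ^ (1 / 5 : ℝ) with hr
    have hK : (0 : ℝ) < (K + 1 : ℕ) := by positivity
    have hspos : 0 < s := by positivity
    have hr0 : 0 ≤ r := by positivity
    have hs5 : s ^ 5 = K + 1 := by
      rw [hs, ← rpow_natCast, ← rpow_mul hK.le]; norm_num
    have hr5 : r ^ 5 = K := by
      rw [hr, ← rpow_natCast, ← rpow_mul (Nat.cast_nonneg _)]; norm_num
    have hs4 : ((K + 1 : ℕ) : ℝ) ^ (-(4 / 5) : ℝ) = 1 / s ^ 4 := by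
      rw [hs, ← rpow_natCast, ← rpow_mul hK.le, rpow_neg hK.le, one_div]; norm_num
    have hrs : r ≤ s := by
      apply rpow_le_rpow <;> first | positivity | (push_cast; linarith)
    have key : 1 / s ^ 4 ≤ 5 * (s - r) := by
      rw [div_le_iff₀ (by positivity)]
      have h1 : r ^ 4 ≤ s ^ 4 := by gcongr
      have h2 : r ^ 3 * s ≤ s ^ 3 * s := by gcongr
      have h3 : r ^ 2 * s ^ 2 ≤ s ^ 2 * s ^ 2 := by gcongr
      have h4 : r * s ^ 3 ≤ s * s ^ 3 := by gcongr
      have h5 : s ^ 4 + s ^ 3 * r + s ^ 2 * r ^ 2 + s * r ^ 3 + r ^ 4 ≤ 5 * s ^ 4 := by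
        linarith
      have h6 := mul_le_mul_of_nonneg_left h5 (sub_nonneg.2 hrs)
      nlinarith
    rw [hs4]; linarith

theorem le_rpow_mul_rpow_of_mul_le_one {T M y : ℝ} (hT : 0 ≤ T) (hM : T ≤ M) (hy : 0 < y)
    (h : T * y ≤ 1) : T ≤ M ^ (1 / 5 : ℝ) * y ^ (-(4 / 5) : ℝ) := by
  have hT' : T = T ^ (1 / 5 : ℝ) * T ^ (4 / 5 : ℝ) := by
    rcases hT.eq_or_lt with rfl | h0
    · norm_num
    · rw [← rpow_add h0]; norm_num
  rw [hT', rpow_neg hy.le, ← inv_rpow hy.le]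
  have hM0 : 0 ≤ M := hT.trans hM
  have : T ≤ y⁻¹ := by rw [← one_div, le_div_iff₀ hy]; exact h
  gcongr

theorem sum_not_dvd_le {T : ℕ → ℝ} {α : ℝ} {M q : ℕ} {a : ℤ} (hM : 1 ≤ M) (hq : 1 ≤ q)
    (hqM : q ≤ 2 * M) (hcop : IsCoprime a (q : ℤ)) (hα : |α - a / q| ≤ 1 / (2 * M * q))
    (hT0 : ∀ d, 0 ≤ T d) (hTM : ∀ d, T d ≤ M)
    (hT : ∀ d : ℕ, ∃ k : ℤ, T d * |d * α - k| ≤ 1) :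
    ∑ d ∈ Icc 1 M with ¬ q ∣ d, T d ≤ 60 * (M : ℝ) ^ (6 / 5 : ℝ) := by
  have hM' : (0 : ℝ) < M := by exact_mod_cast hM
  have hq' : (0 : ℝ) < q := by exact_mod_cast hq
  have hqz : (0 : ℤ) < q := by exact_mod_cast hq
  let ρ : ℕ → ℕ := fun d => ((d * a) % q).toNat
  have hρz : ∀ d, (ρ d : ℤ) = (d * a) % q := fun d =>
    Int.toNat_of_nonneg (Int.emod_nonneg _ hqz.ne')
  have hρlt : ∀ d, ρ d < q := fun d => by
    have := Int.emod_lt_of_pos (d * a) hqz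
    rw [← hρz] at this; exact_mod_cast this
  have hρpos : ∀ d, ¬ q ∣ d → 1 ≤ ρ d := fun d hd => by
    by_contra! h
    have h0 : ((d : ℤ) * a) % q = 0 := by rw [← hρz]; omega
    exact hd (Int.natCast_dvd_natCast.1 (hcop.symm.dvd_of_dvd_mul_right (Int.dvd_of_emod_eq_zero h0)))
  let w : ℕ → ℝ := fun r => (r : ℝ) ^ (-(4 / 5) : ℝ) + ((q - r : ℕ) : ℝ) ^ (-(4 / 5) : ℝ)
  have hterm : ∀ d ∈ (Icc 1 M).filter (fun d => ¬ q ∣ d),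
      T d ≤ (M : ℝ) ^ (1 / 5 : ℝ) * (2 * q) ^ (4 / 5 : ℝ) * w (ρ d) := by
    intro d hd
    obtain ⟨hd1, hd2⟩ := mem_filter.1 hd
    have hdM : (d : ℝ) ≤ M := by exact_mod_cast (mem_Icc.1 hd1).2
    obtain ⟨k, hk⟩ := hT d
    set r := ρ d with hr
    have hr1 : 1 ≤ r := hρpos d hd2
    have hrq : r < q := hρlt d
    set s := min r (q - r) with hs
    have hs1 : 1 ≤ s := le_min hr1 (by omega)
    have hs0 : (0 : ℝ) < s := by exact_mod_cast hs1
    have hdist : (s : ℝ) / (2 * q) ≤ |d * α - k| := by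
      have hle_int : (s : ℤ) ≤ |d * a - q * k| := by
        have hdiv := Int.emod_add_mul_ediv (d * a) q
        rw [← hρz] at hdiv
        set e := (d * a) / (q : ℤ)
        have hrew : (d * a - q * k : ℤ) = r + q * (e - k) := by rw [← hdiv, ← hr]; ring
        rw [hrew]
        have hs2 : s ≤ r := min_le_left _ _
        have hs3 : s ≤ q - r := min_le_right _ _
        rcases le_or_gt 0 (e - k) with h | h
        · have : 0 ≤ q * (e - k) := by positivity
          rw [abs_of_nonneg (by omega)]; omega
        · have : (q : ℤ) * (e - k) ≤ q * (-1) := by gcongr; omega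
          rw [abs_of_nonpos (by omega)]; omega
      have hle_int' : (s : ℝ) ≤ |(d : ℝ) * (a : ℝ) - q * k| := by exact_mod_cast hle_int
      have h1 : (s : ℝ) / q ≤ |(d : ℝ) * (a / q) - k| := by
        have e : (d : ℝ) * a - q * k = ((d : ℝ) * (a / q) - k) * q := by field_simp
        rwa [div_le_iff₀ hq', ← Nat.abs_cast q, ← abs_mul, Nat.abs_cast, ← e]
      have h2 : |d * (α - a / q)| ≤ 1 / (2 * q) := by
        rw [abs_mul, Nat.abs_cast]
        calc (d : ℝ) * |α - a / q| ≤ M * (1 / (2 * M * q)) := by gcongr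
          _ = 1 / (2 * q) := by field_simp
      have h3 : |(d : ℝ) * (a / q) - k| ≤ |d * α - k| + |d * (α - a / q)| := by
        have e : (d : ℝ) * (a / q) - k = (d * α - k) - d * (α - a / q) := by ring
        rw [e]; exact abs_sub _ _
      have h4 : (1 : ℝ) / (2 * q) ≤ s / (2 * q) := by gcongr; exact_mod_cast hs1
      have h5 : (s : ℝ) / q = s / (2 * q) + s / (2 * q) := by field_simp; norm_num
      linarith
    have hle : T d * (s / (2 * q)) ≤ 1 :=
      (mul_le_mul_of_nonneg_left hdist (hT0 d)).trans hk
    refine (le_rpow_mul_rpow_of_mul_le_one (hT0 d) (hTM d) (by positivity) hle).trans ?_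
    rw [mul_assoc]
    gcongr
    rw [div_rpow hs0.le (by positivity), div_eq_mul_inv, mul_comm, ← rpow_neg (by positivity),
      neg_neg]
    gcongr
    rcases min_choice r (q - r) with h | h
    · rw [hs, h]; exact le_add_of_nonneg_right (by positivity)
    · rw [hs, h]; exact le_add_of_nonneg_left (by positivity)
  have hsum : ∑ d ∈ Icc 1 M with ¬ q ∣ d, w (ρ d) ≤ (M / q + 1 : ℕ) * ∑ r ∈ Ico 1 q, w r := by
    have hprod : ∑ p ∈ range (M / q + 1) ×ˢ Ico 1 q, w p.2 =
        (M / q + 1 : ℕ) * ∑ r ∈ Ico 1 q, w r := by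
      rw [sum_product]; simp
    rw [← hprod]
    have hinj : Set.InjOn (fun d => (d / q, ρ d)) ((Icc 1 M).filter (fun d => ¬ q ∣ d)) := by
      intro d _ d' _ h
      obtain ⟨h1, h2⟩ := Prod.mk.inj h
      have h3 : (d * a) % q = (d' * a) % (q : ℤ) := by rw [← hρz, ← hρz, h2]
      have h4 : (d : ℤ) % q = d' % q := by
        have h5 : (q : ℤ) ∣ (d - d') * a := by
          rw [sub_mul]; exact Int.ModEq.dvd (show Int.ModEq q _ _ from h3.symm)
        exact (Int.ModEq.symm (Int.modEq_iff_dvd.2 (hcop.symm.dvd_of_dvd_mul_right h5)))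
      have h5 : d % q = d' % q := by exact_mod_cast h4
      rw [← Nat.div_add_mod d q, ← Nat.div_add_mod d' q, h5, h1]
    calc ∑ d ∈ Icc 1 M with ¬ q ∣ d, w (ρ d)
        = ∑ p ∈ ((Icc 1 M).filter (fun d => ¬ q ∣ d)).image (fun d => (d / q, ρ d)), w p.2 := by
          rw [sum_image hinj]
      _ ≤ _ := by
          refine sum_le_sum_of_subset_of_nonneg ?_ fun p _ _ => by positivity
          intro p hp
          obtain ⟨d, hd, rfl⟩ := mem_image.1 hp
          obtain ⟨hd1, hd2⟩ := mem_filter.1 hd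
          refine mem_product.2 ⟨mem_range.2 ?_, mem_Ico.2 ⟨hρpos d hd2, hρlt d⟩⟩
          exact Nat.lt_succ_of_le (Nat.div_le_div_right (mem_Icc.1 hd1).2)
  have hw : ∑ r ∈ Ico 1 q, w r ≤ 10 * (q : ℝ) ^ (1 / 5 : ℝ) := by
    have h1 : ∑ r ∈ Ico 1 q, (r : ℝ) ^ (-(4 / 5) : ℝ) ≤ 5 * (q : ℝ) ^ (1 / 5 : ℝ) := by
      refine (sum_le_sum_of_subset_of_nonneg (fun x hx => ?_) fun p _ _ => by positivity).trans
        (sum_Icc_rpow_neg_le q)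
      simp only [mem_Ico, mem_Icc] at hx ⊢; omega
    have h2 : ∑ r ∈ Ico 1 q, ((q - r : ℕ) : ℝ) ^ (-(4 / 5) : ℝ) =
        ∑ r ∈ Ico 1 q, (r : ℝ) ^ (-(4 / 5) : ℝ) := by
      refine sum_nbij' (fun r => q - r) (fun r => q - r) ?_ ?_ ?_ ?_ ?_ <;> intro r hr <;>
        simp only [mem_Ico] at hr ⊢ <;> omega
    rw [sum_add_distrib, h2]; linarith
  have hdiv : ((M / q : ℕ) : ℝ) * q ≤ M := by exact_mod_cast Nat.div_mul_le_self M q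
  have hqM' : (q : ℝ) ≤ 2 * M := by exact_mod_cast hqM
  calc ∑ d ∈ Icc 1 M with ¬ q ∣ d, T d
      ≤ (M : ℝ) ^ (1 / 5 : ℝ) * (2 * q) ^ (4 / 5 : ℝ) *
          ∑ d ∈ Icc 1 M with ¬ q ∣ d, w (ρ d) := by
        rw [mul_sum]; exact sum_le_sum hterm
    _ ≤ (M : ℝ) ^ (1 / 5 : ℝ) * (2 * q) ^ (4 / 5 : ℝ) *
          ((M / q + 1 : ℕ) * (10 * (q : ℝ) ^ (1 / 5 : ℝ))) := by
        gcongr; exact hsum.trans (by gcongr)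
    _ ≤ (M : ℝ) ^ (1 / 5 : ℝ) * (2 * q ^ (4 / 5 : ℝ)) *
          ((M / q + 1 : ℕ) * (10 * (q : ℝ) ^ (1 / 5 : ℝ))) := by
        gcongr
        rw [mul_rpow (by norm_num) hq'.le]
        gcongr
        calc (2 : ℝ) ^ (4 / 5 : ℝ) ≤ 2 ^ (1 : ℝ) :=
              rpow_le_rpow_of_exponent_le (by norm_num) (by norm_num)
          _ = 2 := rpow_one 2
    _ = (M : ℝ) ^ (1 / 5 : ℝ) * (20 * (((M / q : ℕ) * q) + q)) := by
        have : (q : ℝ) ^ (4 / 5 : ℝ) * (q : ℝ) ^ (1 / 5 : ℝ) = q := by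
          rw [← rpow_add hq']; norm_num
        rw [Nat.cast_add_one]
        linear_combination (M : ℝ) ^ (1 / 5 : ℝ) * 20 * ((M / q : ℕ) + 1) * this
    _ ≤ (M : ℝ) ^ (1 / 5 : ℝ) * (60 * M) := by exact mul_le_mul_of_nonneg_left (by linarith) (by positivity)
    _ = 60 * (M : ℝ) ^ (6 / 5 : ℝ) := by
        rw [show (6 / 5 : ℝ) = 1 / 5 + 1 by norm_num, rpow_add hM', rpow_one]; ring

theorem sum_dvd_rpow_mul_le {T : ℕ → ℝ} {α : ℝ} {M q : ℕ} {a : ℤ} (hM : 1 ≤ M) (hq : 1 ≤ q)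
    (hα : |α - a / q| ≤ 1 / (2 * M * q))
    (hT0 : ∀ d, 0 ≤ T d) (hTM : ∀ d, T d ≤ M)
    (hT : ∀ d : ℕ, ∃ k : ℤ, T d * |d * α - k| ≤ 1) :
    (∑ d ∈ Icc 1 M with q ∣ d, T d) ^ (5 / 2 : ℝ) ≤
      57 * ((M : ℝ) ^ 2 / q) ^ (5 / 2 : ℝ) / (1 + ((M : ℝ) ^ 2 * (α - a / q)) ^ 2) := by
  have hM' : (0 : ℝ) < M := by exact_mod_cast hM
  have hq' : (0 : ℝ) < q := by exact_mod_cast hq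
  set K := M / q with hKdef
  have hKq : (K : ℝ) * q ≤ M := by exact_mod_cast Nat.div_mul_le_self M q
  have hKM : (K : ℝ) ≤ M / q := by rwa [le_div_iff₀ hq']
  have hB : ∑ d ∈ Icc 1 M with q ∣ d, T d = ∑ k ∈ Icc 1 K, T (q * k) := by
    symm
    refine sum_nbij (fun k => q * k) ?_ ?_ ?_ fun _ _ => rfl
    · intro k hk
      simp only [mem_Icc, mem_filter] at hk ⊢
      have := (Nat.le_div_iff_mul_le hq).1 hk.2
      exact ⟨⟨Nat.mul_pos hq hk.1, by rwa [mul_comm]⟩, dvd_mul_right _ _⟩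
    · intro k _ k' _ h
      exact Nat.eq_of_mul_eq_mul_left hq h
    · intro d hd
      simp only [coe_filter, mem_Icc, Set.mem_ofPred_eq, Set.mem_image, mem_coe] at hd ⊢
      obtain ⟨⟨h1, h2⟩, k, rfl⟩ := hd
      exact ⟨k, ⟨Nat.pos_of_mul_pos_left h1,
        (Nat.le_div_iff_mul_le hq).2 (by rwa [mul_comm])⟩, rfl⟩
  rw [hB]
  set B := ∑ k ∈ Icc 1 K, T (q * k) with hBdef
  have hB0 : 0 ≤ B := sum_nonneg fun _ _ => hT0 _
  set β := |α - a / q| with hβ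
  have hB1 : B ≤ (M : ℝ) ^ 2 / q := by
    calc B ≤ ∑ k ∈ Icc 1 K, (M : ℝ) := sum_le_sum fun _ _ => hTM _
      _ = K * M := by simp
      _ ≤ M / q * M := by gcongr
      _ = _ := by ring
  set x := (M : ℝ) ^ 2 * β with hx
  have hx0 : 0 ≤ x := by positivity
  have hB2 : B * x ^ (4 / 5 : ℝ) ≤ 5 * ((M : ℝ) ^ 2 / q) := by
    rcases (abs_nonneg (α - a / q)).eq_or_lt with h0 | h0
    · rw [← hβ] at h0
      rw [hx, ← h0, mul_zero, zero_rpow (by norm_num), mul_zero]; positivity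
    rw [← hβ] at h0
    have hterm : ∀ k ∈ Icc 1 K, T (q * k) ≤
        (M : ℝ) ^ (1 / 5 : ℝ) * (q * β) ^ (-(4 / 5) : ℝ) * (k : ℝ) ^ (-(4 / 5) : ℝ) := by
      intro k hk
      obtain ⟨hk1, hk2⟩ := mem_Icc.1 hk
      have hk1' : (0 : ℝ) < k := by exact_mod_cast hk1
      have hk2' : (k : ℝ) ≤ K := by exact_mod_cast hk2
      obtain ⟨m, hm⟩ := hT (q * k)
      have hhalf : q * β * k ≤ 1 / 2 := by
        calc q * β * k ≤ q * (1 / (2 * M * q)) * (M / q) := by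
              gcongr; exact hk2'.trans hKM
          _ = 1 / (2 * q) := by field_simp
          _ ≤ 1 / (2 * 1) := by gcongr; exact_mod_cast hq
          _ = 1 / 2 := by norm_num
      have habs : |(q * k : ℕ) * α - (k * a : ℤ)| = q * β * k := by
        have e : ((q * k : ℕ) : ℝ) * α - (k * a : ℤ) = q * (α - a / q) * k := by
          push_cast; field_simp
        rw [e, abs_mul, abs_mul, Nat.abs_cast, Nat.abs_cast]
      have hdist : q * β * k ≤ |(q * k : ℕ) * α - m| := by
        by_cases hmk : m = k * a
        · rw [hmk, habs]
        · have h1 : (1 : ℝ) ≤ |((m : ℝ) - (k * a : ℤ))| := by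
            exact_mod_cast Int.one_le_abs (sub_ne_zero.2 hmk)
          have h2 := abs_sub_le (m : ℝ) ((q * k : ℕ) * α) (k * a : ℤ)
          rw [habs, abs_sub_comm (m : ℝ) ((q * k : ℕ) * α)] at h2
          linarith
      rw [mul_assoc, ← mul_rpow (by positivity) (by positivity)]
      exact le_rpow_mul_rpow_of_mul_le_one (hT0 _) (hTM _) (by positivity)
        ((mul_le_mul_of_nonneg_left hdist (hT0 _)).trans hm)
    have h1 : B ≤ (M : ℝ) ^ (1 / 5 : ℝ) * (q * β) ^ (-(4 / 5) : ℝ) *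
        (5 * ((M : ℝ) / q) ^ (1 / 5 : ℝ)) := by
      calc B ≤ ∑ k ∈ Icc 1 K, (M : ℝ) ^ (1 / 5 : ℝ) * (q * β) ^ (-(4 / 5) : ℝ) *
            (k : ℝ) ^ (-(4 / 5) : ℝ) := sum_le_sum hterm
        _ ≤ (M : ℝ) ^ (1 / 5 : ℝ) * (q * β) ^ (-(4 / 5) : ℝ) * (5 * (K : ℝ) ^ (1 / 5 : ℝ)) := by
            rw [← mul_sum]; gcongr; exact sum_Icc_rpow_neg_le K
        _ ≤ _ := by gcongr
    calc B * x ^ (4 / 5 : ℝ) ≤ (M : ℝ) ^ (1 / 5 : ℝ) * (q * β) ^ (-(4 / 5) : ℝ) *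
        (5 * ((M : ℝ) / q) ^ (1 / 5 : ℝ)) * x ^ (4 / 5 : ℝ) := by gcongr
      _ = 5 * ((M : ℝ) ^ 2 / q) := by
        have e1 : x ^ (4 / 5 : ℝ) = ((M : ℝ) ^ 2 / q) ^ (4 / 5 : ℝ) * (q * β) ^ (4 / 5 : ℝ) := by
          rw [← mul_rpow (by positivity) (by positivity), hx]; congr 1; field_simp
        have e2 : (M : ℝ) ^ (1 / 5 : ℝ) * ((M : ℝ) / q) ^ (1 / 5 : ℝ) =
            ((M : ℝ) ^ 2 / q) ^ (1 / 5 : ℝ) := by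
          rw [← mul_rpow (by positivity) (by positivity)]; congr 1; ring
        have e3 : (q * β) ^ (-(4 / 5) : ℝ) * (q * β) ^ (4 / 5 : ℝ) = 1 := by
          rw [← rpow_add (by positivity)]; norm_num
        have e4 : ((M : ℝ) ^ 2 / q) ^ (1 / 5 : ℝ) * ((M : ℝ) ^ 2 / q) ^ (4 / 5 : ℝ) =
            (M : ℝ) ^ 2 / q := by
          rw [← rpow_add (by positivity)]; norm_num
        rw [e1]
        linear_combination 5 * ((M : ℝ) ^ 2 / q) ^ (4 / 5 : ℝ) * (q * β) ^ (-(4 / 5) : ℝ) *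
          (q * β) ^ (4 / 5 : ℝ) * e2 + 5 * (q * β) ^ (-(4 / 5) : ℝ) * (q * β) ^ (4 / 5 : ℝ) * e4 +
          5 * ((M : ℝ) ^ 2 / q) * e3
  have hx2 : ((M : ℝ) ^ 2 * (α - a / q)) ^ 2 = x ^ 2 := by
    rw [hx, mul_pow, mul_pow, hβ, sq_abs]
  rw [hx2, le_div_iff₀ (by positivity), mul_add, mul_one]
  have h1 : B ^ (5 / 2 : ℝ) ≤ ((M : ℝ) ^ 2 / q) ^ (5 / 2 : ℝ) := by gcongr
  have h2 : B ^ (5 / 2 : ℝ) * x ^ 2 ≤ 56 * ((M : ℝ) ^ 2 / q) ^ (5 / 2 : ℝ) := by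
    have e1 : B ^ (5 / 2 : ℝ) * x ^ 2 = (B * x ^ (4 / 5 : ℝ)) ^ (5 / 2 : ℝ) := by
      rw [mul_rpow hB0 (by positivity), ← rpow_mul hx0, ← rpow_natCast]; norm_num
    have e2 : (5 : ℝ) ^ (5 / 2 : ℝ) ≤ 56 := by
      have : ((5 : ℝ) ^ (5 / 2 : ℝ)) ^ 2 = 5 ^ 5 := by
        rw [← rpow_natCast, ← rpow_mul (by norm_num)]; norm_num
      nlinarith [rpow_nonneg (show (0 : ℝ) ≤ 5 by norm_num) (5 / 2)]
    rw [e1]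
    calc (B * x ^ (4 / 5 : ℝ)) ^ (5 / 2 : ℝ) ≤ (5 * ((M : ℝ) ^ 2 / q)) ^ (5 / 2 : ℝ) := by gcongr
      _ = 5 ^ (5 / 2 : ℝ) * ((M : ℝ) ^ 2 / q) ^ (5 / 2 : ℝ) :=
          mul_rpow (by norm_num) (by positivity)
      _ ≤ _ := by gcongr
  linarith

/-- The major-arc majorant of the fifth power of a quadratic Weyl sum of length `M`. -/
noncomputable def weylMajorant (M : ℕ) (t : ℝ) : ℝ :=
  (M : ℝ) ^ 3 + ∑ q ∈ Icc 1 (2 * M), ∑ a ∈ range (4 * q + 1),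
    ((M : ℝ) ^ 2 / q) ^ (5 / 2 : ℝ) / (1 + ((M : ℝ) ^ 2 * (2 * t / π - a / q)) ^ 2)

theorem norm_weyl_sum_pow_five_le {M : ℕ} (hM : 1 ≤ M) (b c : ℝ) {t : ℝ}
    (ht : t ∈ Set.Icc 0 (2 * π)) :
    ‖∑ h ∈ range M, Complex.exp ((t * (2 * h ^ 2 + b * h + c) : ℝ) * Complex.I)‖ ^ 5 ≤
      (242 ^ 3 + 32 * 57) * weylMajorant M t := by
  have hM' : (1 : ℝ) ≤ M := by exact_mod_cast hM
  have hM0 : (0 : ℝ) < M := by linarith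
  set S := ‖∑ h ∈ range M, Complex.exp ((t * (2 * h ^ 2 + b * h + c) : ℝ) * Complex.I)‖ with hS
  have hS0 : 0 ≤ S := norm_nonneg _
  set α := 2 * t / π with hαdef
  have hα0 : 0 ≤ α := div_nonneg (by linarith [ht.1]) pi_pos.le
  have hα4 : α ≤ 4 := by rw [hαdef, div_le_iff₀ pi_pos]; linarith [ht.2]
  let T : ℕ → ℝ := fun d => ‖∑ h ∈ range (M - d),
    Complex.exp ((4 * t * (d : ℝ) * h : ℝ) * Complex.I)‖
  have hT0 : ∀ d, 0 ≤ T d := fun d => norm_nonneg _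
  have hTM : ∀ d, T d ≤ M := fun d => by
    refine (norm_sum_le _ _).trans ?_
    simp only [Complex.norm_exp_ofReal_mul_I, sum_const, card_range, nsmul_eq_mul, mul_one]
    exact_mod_cast Nat.sub_le M d
  have hT : ∀ d : ℕ, ∃ k : ℤ, T d * |d * α - k| ≤ 1 := fun d => by
    obtain ⟨k, hk⟩ := norm_geom_sum_exp_mul_le (4 * t * d) (M - d)
    refine ⟨k, ?_⟩
    have e : (d : ℝ) * α = 4 * t * d / (2 * π) := by rw [hαdef]; field_simp; ring
    rwa [e]
  have hweyl : S ^ 2 ≤ M + 2 * ∑ d ∈ Icc 1 M, T d := by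
    have h1 := norm_weyl_sum_sq_le t b c M
    have h2 : ∑ d ∈ range M, T (d + 1) = ∑ d ∈ Icc 1 M, T d := by
      rw [range_eq_Ico, sum_Ico_add' T 0 M 1]; rfl
    rw [← h2]; exact h1
  obtain ⟨r, hr, hrden⟩ := Real.exists_rat_abs_sub_le_and_den_le α (n := 2 * M) (by omega)
  set q := r.den with hq
  have hq1 : 1 ≤ q := r.pos
  have hq1' : (1 : ℝ) ≤ q := by exact_mod_cast hq1
  have hrcast : (r : ℝ) = (r.num : ℝ) / q := Rat.cast_def r
  rw [hrcast] at hr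
  have hrα : |α - (r.num : ℝ) / q| ≤ 1 / (2 * M * q) := by
    refine hr.trans ?_
    push_cast
    gcongr
    linarith
  have hcop : IsCoprime r.num (q : ℤ) := by
    rw [Int.isCoprime_iff_gcd_eq_one]; exact r.reduced
  have hsmall : |q * α - r.num| < 1 := by
    have e : (q : ℝ) * α - r.num = q * (α - r.num / q) := by field_simp
    rw [e, abs_mul, Nat.abs_cast]
    calc (q : ℝ) * |α - r.num / q| ≤ q * (1 / (2 * M * q)) := by gcongr
      _ = 1 / (2 * M) := by field_simp
      _ < 1 := by rw [div_lt_one (by positivity)]; linarith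
  obtain ⟨hs1, hs2⟩ := abs_lt.1 hsmall
  have hnum0 : 0 ≤ r.num := by
    have : (-1 : ℝ) < r.num := by nlinarith
    have : -1 < r.num := by exact_mod_cast this
    omega
  have hnum4 : r.num < 4 * q + 1 := by
    have : (r.num : ℝ) < 4 * q + 1 := by nlinarith
    exact_mod_cast this
  obtain ⟨a, ha⟩ := Int.eq_ofNat_of_zero_le hnum0
  have hminor := sum_not_dvd_le hM hq1 hrden hcop hrα hT0 hTM hT
  have hmajor := sum_dvd_rpow_mul_le hM hq1 hrα hT0 hTM hT
  have hsplit := sum_filter_add_sum_filter_not (Icc 1 M) (fun d => q ∣ d) T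
  set B := ∑ d ∈ Icc 1 M with q ∣ d, T d
  have hB0 : 0 ≤ B := sum_nonneg fun _ _ => hT0 _
  set u := (M : ℝ) ^ (6 / 5 : ℝ) with hu
  have hMu : (M : ℝ) ≤ u := by
    conv_lhs => rw [← rpow_one (M : ℝ)]
    exact rpow_le_rpow_of_exponent_le hM' (by norm_num)
  have hu0 : 0 ≤ u := hM0.le.trans hMu
  have hS2 : S ^ 2 ≤ 2 * max (121 * u) (2 * B) := by
    have h1 := le_max_left (121 * u) (2 * B)
    have h2 := le_max_right (121 * u) (2 * B)
    linarith
  have hS5 : S ^ 5 = (S ^ 2) ^ (5 / 2 : ℝ) := by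
    rw [← rpow_natCast S 2, ← rpow_mul hS0, ← rpow_natCast]; norm_num
  have h242 : (242 * u) ^ (5 / 2 : ℝ) ≤ 242 ^ 3 * (M : ℝ) ^ 3 := by
    rw [mul_rpow (by norm_num) hu0, hu, ← rpow_mul hM0.le, ← rpow_natCast, ← rpow_natCast]
    norm_num only
    gcongr ?_ * _
    calc (242 : ℝ) ^ (5 / 2 : ℝ) ≤ 242 ^ (3 : ℝ) :=
          rpow_le_rpow_of_exponent_le (by norm_num) (by norm_num)
      _ = 14172488 := by norm_num
  have h4 : (4 * B) ^ (5 / 2 : ℝ) = 32 * B ^ (5 / 2 : ℝ) := by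
    rw [mul_rpow (by norm_num) hB0]
    congr 1
    rw [show (4 : ℝ) = 2 ^ (2 : ℝ) by norm_num, ← rpow_mul (by norm_num)]
    norm_num
  have hterm : ((M : ℝ) ^ 2 / q) ^ (5 / 2 : ℝ) /
      (1 + ((M : ℝ) ^ 2 * (α - (r.num : ℝ) / q)) ^ 2) ≤ ∑ q ∈ Icc 1 (2 * M),
      ∑ a ∈ range (4 * q + 1),
        ((M : ℝ) ^ 2 / q) ^ (5 / 2 : ℝ) / (1 + ((M : ℝ) ^ 2 * (2 * t / π - a / q)) ^ 2) := by
    refine le_trans ?_ (single_le_sum (f := fun q : ℕ => ∑ a ∈ range (4 * q + 1),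
      ((M : ℝ) ^ 2 / q) ^ (5 / 2 : ℝ) / (1 + ((M : ℝ) ^ 2 * (2 * t / π - a / q)) ^ 2))
      (fun _ _ => sum_nonneg fun _ _ => by positivity) (mem_Icc.2 ⟨hq1, hrden⟩))
    refine le_trans (le_of_eq ?_) (single_le_sum (f := fun a : ℕ =>
      ((M : ℝ) ^ 2 / q) ^ (5 / 2 : ℝ) / (1 + ((M : ℝ) ^ 2 * (2 * t / π - a / q)) ^ 2))
      (fun _ _ => by positivity) (mem_range.2 (by omega : a < 4 * q + 1)))
    simp only [ha, hαdef, Int.cast_natCast]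
  have hmax : S ^ 5 ≤ (242 * u) ^ (5 / 2 : ℝ) + (4 * B) ^ (5 / 2 : ℝ) := by
    rw [hS5]
    rcases max_choice (121 * u) (2 * B) with h | h <;> rw [h] at hS2
    · refine le_add_of_le_of_nonneg ?_ (rpow_nonneg (mul_nonneg (by norm_num) hB0) _)
      exact rpow_le_rpow (sq_nonneg S) (by linarith) (by norm_num)
    · refine le_add_of_nonneg_of_le (rpow_nonneg (mul_nonneg (by norm_num) hu0) _) ?_
      exact rpow_le_rpow (sq_nonneg S) (by linarith) (by norm_num)
  rw [h4] at hmax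
  have hsum0 := le_trans (by positivity : (0:ℝ) ≤ ((M : ℝ) ^ 2 / q) ^ (5 / 2 : ℝ) /
      (1 + ((M : ℝ) ^ 2 * (α - (r.num : ℝ) / q)) ^ 2)) hterm
  have hM3 : (0 : ℝ) ≤ (M : ℝ) ^ 3 := by positivity
  rw [mul_div_assoc] at hmajor
  rw [weylMajorant]
  linarith

theorem continuous_weylMajorant (M : ℕ) : Continuous (weylMajorant M) := by
  unfold weylMajorant
  refine continuous_const.add (continuous_finsetSum _ fun q _ => continuous_finsetSum _ fun a _ =>
    continuous_const.div (by fun_prop) fun t => by positivity)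

theorem integral_inv_one_add_mul_sq_le {m : ℝ} (hm : 0 < m) (c : ℝ) :
    ∫ t in 0..2 * π, (1 + (m * (2 * t / π - c)) ^ 2)⁻¹ ≤ π ^ 2 / (2 * m) := by
  have h1 : ∀ t : ℝ, (1 + (m * (2 * t / π - c)) ^ 2)⁻¹ =
      (fun y : ℝ => (1 + y ^ 2)⁻¹) ((2 * m / π) * t - m * c) := fun t => by
    simp only; congr 3; ring
  simp_rw [h1]
  rw [intervalIntegral.integral_comp_mul_sub (fun y : ℝ => (1 + y ^ 2)⁻¹)
    (by positivity : 2 * m / π ≠ 0), integral_inv_one_add_sq, smul_eq_mul, inv_div]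
  have h2 := arctan_lt_pi_div_two (2 * m / π * (2 * π) - m * c)
  have h3 := neg_pi_div_two_lt_arctan (2 * m / π * 0 - m * c)
  calc _ ≤ π / (2 * m) * π := by gcongr; linarith
    _ = _ := by ring

theorem exists_integral_weylMajorant_le : ∃ C > 0, ∀ M : ℕ, 1 ≤ M →
    ∫ t in 0..2 * π, weylMajorant M t ≤ C * (M : ℝ) ^ 3 := by
  have hsum : Summable fun q : ℕ => ((q : ℝ) ^ (3 / 2 : ℝ))⁻¹ :=
    Real.summable_nat_rpow_inv.2 (by norm_num)
  set Z := ∑' q : ℕ, ((q : ℝ) ^ (3 / 2 : ℝ))⁻¹ with hZ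
  have hZ0 : 0 ≤ Z := tsum_nonneg fun _ => by positivity
  refine ⟨2 * π + 5 * π ^ 2 / 2 * Z, by positivity, fun M hM => ?_⟩
  have hM0 : (0 : ℝ) < M := by exact_mod_cast hM
  have hcont : ∀ q a : ℕ, Continuous fun t : ℝ => ((M : ℝ) ^ 2 / q) ^ (5 / 2 : ℝ) /
      (1 + ((M : ℝ) ^ 2 * (2 * t / π - a / q)) ^ 2) := fun q a =>
    continuous_const.div (by fun_prop) fun t => by positivity
  have hterm : ∀ q ∈ Icc 1 (2 * M), ∫ t in 0..2 * π, ∑ a ∈ range (4 * q + 1),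
      ((M : ℝ) ^ 2 / q) ^ (5 / 2 : ℝ) / (1 + ((M : ℝ) ^ 2 * (2 * t / π - a / q)) ^ 2) ≤
      5 * π ^ 2 / 2 * (M : ℝ) ^ 3 * ((q : ℝ) ^ (3 / 2 : ℝ))⁻¹ := by
    intro q hq
    have hq1 : (1 : ℝ) ≤ q := by exact_mod_cast (mem_Icc.1 hq).1
    rw [intervalIntegral.integral_finsetSum fun a _ => (hcont q a).intervalIntegrable _ _]
    calc _ ≤ ∑ a ∈ range (4 * q + 1),
          ((M : ℝ) ^ 2 / q) ^ (5 / 2 : ℝ) * (π ^ 2 / (2 * (M : ℝ) ^ 2)) := by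
          refine sum_le_sum fun a _ => ?_
          simp_rw [div_eq_mul_inv _ (1 + _ : ℝ)]
          rw [intervalIntegral.integral_const_mul]
          gcongr
          exact integral_inv_one_add_mul_sq_le (by positivity) _
      _ = (4 * q + 1) * (((M : ℝ) ^ 2 / q) ^ (5 / 2 : ℝ) * (π ^ 2 / (2 * (M : ℝ) ^ 2))) := by
          simp
      _ ≤ (5 * q) * (((M : ℝ) ^ 2 / q) ^ (5 / 2 : ℝ) * (π ^ 2 / (2 * (M : ℝ) ^ 2))) := by
          gcongr; linarith
      _ = _ := by
          have e1 : ((M : ℝ) ^ 2) ^ (5 / 2 : ℝ) = (M : ℝ) ^ 5 := by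
            rw [← rpow_natCast, ← rpow_mul hM0.le, ← rpow_natCast]; norm_num
          have e2 : (q : ℝ) ^ (5 / 2 : ℝ) = q * (q : ℝ) ^ (3 / 2 : ℝ) := by
            rw [← rpow_one_add' (by positivity) (by norm_num)]; norm_num
          rw [div_rpow (by positivity) (by positivity), e1, e2]
          field_simp
  have hcont' : ∀ q : ℕ, Continuous fun t : ℝ => ∑ a ∈ range (4 * q + 1),
      ((M : ℝ) ^ 2 / q) ^ (5 / 2 : ℝ) / (1 + ((M : ℝ) ^ 2 * (2 * t / π - a / q)) ^ 2) :=
    fun q => continuous_finsetSum _ fun a _ => hcont q a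
  unfold weylMajorant
  rw [intervalIntegral.integral_add intervalIntegrable_const
    ((continuous_finsetSum _ fun q _ => hcont' q).intervalIntegrable _ _),
    intervalIntegral.integral_const, intervalIntegral.integral_finsetSum fun q _ =>
      (hcont' q).intervalIntegrable _ _, add_mul, sub_zero, smul_eq_mul]
  gcongr
  calc _ ≤ ∑ q ∈ Icc 1 (2 * M), 5 * π ^ 2 / 2 * (M : ℝ) ^ 3 * ((q : ℝ) ^ (3 / 2 : ℝ))⁻¹ :=
        sum_le_sum hterm
    _ ≤ 5 * π ^ 2 / 2 * (M : ℝ) ^ 3 * Z := by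
        rw [← mul_sum]
        gcongr
        exact hsum.sum_le_tsum _ fun _ _ => by positivity
    _ = _ := by ring

theorem integral_exp_int_mul (k : ℤ) :
    ∫ t in 0..2 * π, Complex.exp ((k * t : ℝ) * Complex.I) = if k = 0 then 2 * (π : ℂ) else 0 := by
  split_ifs with hk
  · simp [hk]
  · have hk' : (k : ℂ) * Complex.I ≠ 0 := mul_ne_zero (by exact_mod_cast hk) Complex.I_ne_zero
    have e : ∀ t : ℝ, Complex.exp ((k * t : ℝ) * Complex.I) =
        Complex.exp ((k : ℂ) * Complex.I * t) := fun t => by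
      congr 1; push_cast; ring
    simp_rw [e]
    rw [integral_exp_mul_complex hk']
    have e2 : (k : ℂ) * Complex.I * ((2 * π : ℝ) : ℂ) = k * (2 * π * Complex.I) := by
      push_cast; ring
    rw [e2, Complex.exp_int_mul_two_pi_mul_I]
    simp

/-- Uniform bound for the number of zeros of a quadratic polynomial `∑ⱼ (2hⱼ² + bⱼhⱼ + cⱼ) - τ`
in a discrete cube, for at least five variables. -/
theorem exists_card_quadratic_le (n : ℕ) (hn : 5 ≤ n) : ∃ C > 0, ∀ M : ℕ, 1 ≤ M →
    ∀ (b c : Fin n → ℤ) (τ : ℤ),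
      (#{h ∈ Fintype.piFinset fun _ : Fin n => range M |
        ∑ j, (2 * (h j : ℤ) ^ 2 + b j * h j + c j) = τ} : ℝ) ≤ C * (M : ℝ) ^ (n - 2) := by
  obtain ⟨C, hC, hle_int⟩ := exists_integral_weylMajorant_le
  refine ⟨(242 ^ 3 + 32 * 57) * C, by positivity, fun M hM b c τ => ?_⟩
  let φ : Fin n → ℕ → ℤ := fun j h => 2 * (h : ℤ) ^ 2 + b j * h + c j
  let S : Fin n → ℝ → ℂ := fun j t =>
    ∑ h ∈ range M, Complex.exp ((t * (2 * h ^ 2 + b j * h + c j) : ℝ) * Complex.I)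
  set s := Fintype.piFinset fun _ : Fin n => range M with hs
  have hSM : ∀ j t, ‖S j t‖ ≤ M := fun j t => by
    refine (norm_sum_le _ _).trans ?_
    simp only [Complex.norm_exp_ofReal_mul_I, sum_const, card_range, nsmul_eq_mul, mul_one, le_refl]
  have hprod : ∀ t, Complex.exp ((-τ * t : ℝ) * Complex.I) * ∏ j, S j t =
      ∑ h ∈ s, Complex.exp (((∑ j, φ j (h j) - τ : ℤ) * t : ℝ) * Complex.I) := by
    intro t
    rw [prod_univ_sum, mul_sum]
    refine sum_congr rfl fun h _ => ?_
    rw [← Complex.exp_sum, ← Complex.exp_add, ← sum_mul, ← add_mul]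
    congr 2
    push_cast [φ]
    rw [← mul_sum]
    ring
  have hcount : ∫ t in 0..2 * π, Complex.exp ((-τ * t : ℝ) * Complex.I) * ∏ j, S j t =
      2 * π * (#{h ∈ s | ∑ j, φ j (h j) = τ} : ℂ) := by
    simp_rw [hprod]
    rw [intervalIntegral.integral_finsetSum fun h _ =>
      (Continuous.intervalIntegrable (by fun_prop) _ _)]
    simp_rw [integral_exp_int_mul, sub_eq_zero]
    rw [← sum_filter, sum_const, nsmul_eq_mul, mul_comm]
  have hbound : ∀ t ∈ Set.Icc 0 (2 * π),
      ‖Complex.exp ((-τ * t : ℝ) * Complex.I) * ∏ j, S j t‖ ≤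
        (M : ℝ) ^ (n - 5) * ((242 ^ 3 + 32 * 57) * weylMajorant M t) := by
    intro t ht
    rw [norm_mul, Complex.norm_exp_ofReal_mul_I, one_mul, norm_prod]
    have : Nonempty (Fin n) := ⟨⟨0, by omega⟩⟩
    obtain ⟨j, -, hj⟩ := exists_max_image univ (fun j => ‖S j t‖) univ_nonempty
    calc ∏ i, ‖S i t‖ ≤ ∏ _i : Fin n, ‖S j t‖ :=
          prod_le_prod (fun _ _ => norm_nonneg _) fun i hi => hj i hi
      _ = ‖S j t‖ ^ (n - 5) * ‖S j t‖ ^ 5 := by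
          rw [prod_const, card_univ, Fintype.card_fin, ← pow_add, Nat.sub_add_cancel hn]
      _ ≤ _ := by
          gcongr
          · exact hSM j t
          · exact norm_weyl_sum_pow_five_le hM (b j) (c j) ht
  have hfin : 2 * π * (#{h ∈ s | ∑ j, φ j (h j) = τ} : ℝ) ≤
      (M : ℝ) ^ (n - 5) * ((242 ^ 3 + 32 * 57) * (C * (M : ℝ) ^ 3)) := by
    have e : 2 * π * (#{h ∈ s | ∑ j, φ j (h j) = τ} : ℝ) =
        ‖(2 * π * (#{h ∈ s | ∑ j, φ j (h j) = τ} : ℂ) : ℂ)‖ := by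
      rw [norm_mul, norm_mul, Complex.norm_real, Complex.norm_natCast, Complex.norm_two,
        Real.norm_of_nonneg pi_pos.le]
    rw [e, ← hcount]
    calc _ ≤ ∫ t in 0..2 * π, (M : ℝ) ^ (n - 5) * ((242 ^ 3 + 32 * 57) * weylMajorant M t) :=
          intervalIntegral.norm_integral_le_of_norm_le (by positivity)
            (Filter.Eventually.of_forall fun t ht => hbound t (Set.Ioc_subset_Icc_self ht))
            (((continuous_weylMajorant M).const_mul _).const_mul _ |>.intervalIntegrable _ _)
      _ ≤ _ := by
          rw [intervalIntegral.integral_const_mul, intervalIntegral.integral_const_mul]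
          gcongr
          exact hle_int M hM
  have hpow : (M : ℝ) ^ (n - 2) = (M : ℝ) ^ (n - 5) * (M : ℝ) ^ 3 := by
    rw [← pow_add]; congr 1; omega
  have hcard : (0 : ℝ) ≤ #{h ∈ s | ∑ j, φ j (h j) = τ} := Nat.cast_nonneg _
  rw [hpow]
  change (#{h ∈ s | ∑ j, φ j (h j) = τ} : ℝ) ≤ _
  nlinarith [pi_gt_three]

theorem setIntegral_stBox_exp {n : ℕ} (k : Fin n → ℤ) (m : ℤ) :
    ∫ q in stBox n, Complex.exp (((∑ i, q.2 i * (k i : ℝ)) - q.1 * m : ℝ) * Complex.I) =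
      if k = 0 ∧ m = 0 then (2 * (π : ℂ)) ^ (n + 1) else 0 := by
  have h1d : ∀ l : ℤ, ∫ t in Set.Icc 0 (2 * π), Complex.exp ((l * t : ℝ) * Complex.I) =
      if l = 0 then 2 * (π : ℂ) else 0 := fun l => by
    rw [integral_Icc_eq_integral_Ioc, ← intervalIntegral.integral_of_le (by positivity),
      integral_exp_int_mul]
  have e : ∀ q : ℝ × (Fin n → ℝ),
      Complex.exp (((∑ i, q.2 i * (k i : ℝ)) - q.1 * m : ℝ) * Complex.I) =
        Complex.exp (((-m : ℤ) * q.1 : ℝ) * Complex.I) *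
          ∏ i, Complex.exp ((k i * q.2 i : ℝ) * Complex.I) := fun q => by
    rw [← Complex.exp_sum, ← Complex.exp_add, ← sum_mul, ← add_mul]
    congr 2
    push_cast
    simp_rw [mul_comm (k _ : ℂ)]
    ring
  simp_rw [e]
  rw [stBox, Measure.volume_eq_prod, setIntegral_prod_mul
    (fun t : ℝ => Complex.exp (((-m : ℤ) * t : ℝ) * Complex.I))
    (fun x : Fin n → ℝ => ∏ i, Complex.exp ((k i * x i : ℝ) * Complex.I)), h1d, volume_pi,
    Measure.restrict_pi_pi, integral_fintype_prod_eq_prod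
      (fun i (y : ℝ) => Complex.exp ((k i * y : ℝ) * Complex.I))]
  simp_rw [h1d]
  by_cases hm : m = 0
  · by_cases hk : k = 0
    · simp [hm, hk, pow_succ']
    · obtain ⟨i, hi⟩ := Function.ne_iff.1 hk
      rw [prod_eq_zero (mem_univ i) (if_neg hi), mul_zero, if_neg fun h => hk h.1]
  · rw [if_neg (by simpa using hm), zero_mul, if_neg fun h => hm h.2]

/-- A trigonometric polynomial whose frequencies `(k p, m p)` repeat at most `D` times has
squared `L²` norm at most `D` times the diagonal contribution. -/
theorem setIntegral_stBox_norm_sq_le {n : ℕ} {ι : Type*} (s : Finset ι) (a : ι → ℂ)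
    (k : ι → Fin n → ℤ) (m : ι → ℤ) {D : ℝ}
    (hD : ∀ p ∈ s, (#{p' ∈ s | k p' = k p ∧ m p' = m p} : ℝ) ≤ D) :
    ∫ q in stBox n, ‖∑ p ∈ s, a p *
        Complex.exp (((∑ i, q.2 i * (k p i : ℝ)) - q.1 * m p : ℝ) * Complex.I)‖ ^ 2 ≤
      (2 * π) ^ (n + 1) * D * ∑ p ∈ s, ‖a p‖ ^ 2 := by
  set e : ι → ℝ × (Fin n → ℝ) → ℂ := fun p q =>
    Complex.exp (((∑ i, q.2 i * (k p i : ℝ)) - q.1 * m p : ℝ) * Complex.I) with he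
  have hcompact : IsCompact (stBox n) := isCompact_Icc.prod (isCompact_univ_pi fun _ => isCompact_Icc)
  have hexpand : ∀ q, ((‖∑ p ∈ s, a p * e p q‖ ^ 2 : ℝ) : ℂ) =
      ∑ p ∈ s, ∑ p' ∈ s, a p * (starRingEnd ℂ) (a p') *
        Complex.exp (((∑ i, q.2 i * ((k p - k p') i : ℝ)) - q.1 * (m p - m p' : ℤ) : ℝ) *
          Complex.I) := by
    intro q
    rw [Complex.ofReal_pow, ← Complex.mul_conj', map_sum, sum_mul_sum]
    refine sum_congr rfl fun p _ => sum_congr rfl fun p' _ => ?_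
    rw [map_mul, mul_mul_mul_comm, he, ← Complex.exp_conj, ← Complex.exp_add, map_mul,
      Complex.conj_I, Complex.conj_ofReal]
    congr 2
    simp only [Pi.sub_apply, Int.cast_sub, mul_sub, sum_sub_distrib]
    push_cast
    ring
  have hI : ((∫ q in stBox n, ‖∑ p ∈ s, a p * e p q‖ ^ 2 : ℝ) : ℂ) =
      ∑ p ∈ s, ∑ p' ∈ s, a p * (starRingEnd ℂ) (a p') *
        (if k p - k p' = 0 ∧ m p - m p' = 0 then (2 * (π : ℂ)) ^ (n + 1) else 0) := by
    rw [← integral_complex_ofReal]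
    simp_rw [hexpand]
    have hle_int : ∀ p p', IntegrableOn (fun q : ℝ × (Fin n → ℝ) => a p * (starRingEnd ℂ) (a p') *
        Complex.exp (((∑ i, q.2 i * ((k p - k p') i : ℝ)) - q.1 * (m p - m p' : ℤ) : ℝ) *
          Complex.I)) (stBox n) := fun p p' =>
      ContinuousOn.integrableOn_compact hcompact (Continuous.continuousOn (by fun_prop))
    rw [integral_finsetSum _ fun p _ => integrable_finsetSum _ fun p' _ => hle_int p p']
    refine sum_congr rfl fun p _ => ?_
    rw [integral_finsetSum _ fun p' _ => hle_int p p']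
    refine sum_congr rfl fun p' _ => ?_
    rw [integral_const_mul]
    congr 1
    exact setIntegral_stBox_exp (k p - k p') (m p - m p')
  have hpi : (0 : ℝ) ≤ (2 * π) ^ (n + 1) := by positivity
  let r : ι → ι → ℝ := fun p p' => if k p' = k p ∧ m p' = m p then 1 else 0
  have hr : ∀ p p', r p p' = r p' p := fun p p' => by
    simp only [r, eq_comm]
  have hr0 : ∀ p p', 0 ≤ r p p' := fun p p' => by
    simp only [r]; split_ifs <;> norm_num
  have hrsum : ∀ p ∈ s, ∑ p' ∈ s, r p p' ≤ D := fun p hp => by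
    simp only [r, sum_boole]; exact hD p hp
  have hdiag : ∑ p ∈ s, ∑ p' ∈ s, r p p' * ‖a p‖ ^ 2 ≤ D * ∑ p ∈ s, ‖a p‖ ^ 2 := by
    rw [mul_sum]
    refine sum_le_sum fun p hp => ?_
    rw [← sum_mul]
    exact mul_le_mul_of_nonneg_right (hrsum p hp) (sq_nonneg _)
  have hnn : (0 : ℝ) ≤ ∫ q in stBox n, ‖∑ p ∈ s, a p * e p q‖ ^ 2 :=
    integral_nonneg fun _ => by positivity
  calc ∫ q in stBox n, ‖∑ p ∈ s, a p * e p q‖ ^ 2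
      = ‖((∫ q in stBox n, ‖∑ p ∈ s, a p * e p q‖ ^ 2 : ℝ) : ℂ)‖ := by
        rw [Complex.norm_real, Real.norm_of_nonneg hnn]
    _ ≤ ∑ p ∈ s, ∑ p' ∈ s, ‖a p‖ * ‖a p'‖ * ((2 * π) ^ (n + 1) * r p p') := by
        rw [hI]
        refine (norm_sum_le _ _).trans (sum_le_sum fun p _ => (norm_sum_le _ _).trans
          (sum_le_sum fun p' _ => le_of_eq ?_))
        rw [norm_mul, norm_mul, RCLike.norm_conj]
        congr 1
        simp only [r, sub_eq_zero, eq_comm (a := k p), eq_comm (a := m p)]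
        split_ifs
        · rw [norm_pow, norm_mul, Complex.norm_real, Complex.norm_two,
            Real.norm_of_nonneg pi_pos.le, mul_one]
        · simp
    _ ≤ ∑ p ∈ s, ∑ p' ∈ s, (2 * π) ^ (n + 1) *
          ((r p p' * ‖a p‖ ^ 2 + r p' p * ‖a p'‖ ^ 2) / 2) := by
        refine sum_le_sum fun p _ => sum_le_sum fun p' _ => ?_
        rw [← hr p p']
        have h1 : ‖a p‖ * ‖a p'‖ ≤ (‖a p‖ ^ 2 + ‖a p'‖ ^ 2) / 2 := by
          nlinarith [sq_nonneg (‖a p‖ - ‖a p'‖)]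
        have h2 := mul_le_mul_of_nonneg_right h1 (mul_nonneg hpi (hr0 p p'))
        linarith
    _ = (2 * π) ^ (n + 1) * ∑ p ∈ s, ∑ p' ∈ s, r p p' * ‖a p‖ ^ 2 := by
        simp_rw [← mul_sum, ← sum_div, sum_add_distrib]
        rw [sum_comm (f := fun p p' => r p' p * ‖a p'‖ ^ 2)]
        ring
    _ ≤ (2 * π) ^ (n + 1) * (D * ∑ p ∈ s, ‖a p‖ ^ 2) := by gcongr
    _ = _ := by ring

/-- The number of `(ξ₁, ξ₂)` with prescribed `ξ₁ + ξ₂` and `|ξ₁|² + |ξ₂|²` and with `ξ₁` in a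
cube of side length `2N` is `O(N ^ (n - 2))`, uniformly in the position of the cube. -/
theorem exists_card_resonance_le (n : ℕ) (hn : 5 ≤ n) : ∃ C > 0, ∀ N : ℝ, 1 ≤ N →
    ∀ (ξ₀ ζ : Fin n → ℤ) (τ : ℤ) (s : Finset ((Fin n → ℤ) × (Fin n → ℤ))),
      (∀ p ∈ s, ∀ i, |(p.1 i : ℝ) - ξ₀ i| ≤ N) → (∀ p ∈ s, p.1 + p.2 = ζ) →
      (∀ p ∈ s, ∑ i, p.1 i ^ 2 + ∑ i, p.2 i ^ 2 = τ) → (#s : ℝ) ≤ C * N ^ (n - 2) := by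
  obtain ⟨C, hC, hcard⟩ := exists_card_quadratic_le n hn
  refine ⟨C * 3 ^ (n - 2), by positivity, fun N hN ξ₀ ζ τ s hcube hζ hτ => ?_⟩
  set L := ⌊N⌋₊
  have hL : (L : ℝ) ≤ N := Nat.floor_le (by linarith)
  have hLcube : ∀ p ∈ s, ∀ i, |p.1 i - ξ₀ i| ≤ (L : ℤ) := fun p hp i => by
    have h1 : (((p.1 i - ξ₀ i).natAbs : ℕ) : ℝ) ≤ N := by
      rw [Nat.cast_natAbs]; push_cast; exact hcube p hp i
    have h2 := Nat.le_floor h1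
    rw [Int.abs_eq_natAbs]; exact_mod_cast h2
  let v : Fin n → ℤ := fun i => ξ₀ i - L
  let f : (Fin n → ℤ) × (Fin n → ℤ) → Fin n → ℕ := fun p i => (p.1 i - v i).toNat
  have hf : ∀ p ∈ s, ∀ i, (f p i : ℤ) = p.1 i - v i := fun p hp i => by
    have := abs_le.1 (hLcube p hp i)
    exact Int.toNat_of_nonneg (by simp only [v]; omega)
  have hle : #s ≤ #{h ∈ Fintype.piFinset fun _ : Fin n => range (2 * L + 1) |
      ∑ j, (2 * (h j : ℤ) ^ 2 + (2 * v j - 2 * (ζ j - v j)) * h j +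
        (v j ^ 2 + (ζ j - v j) ^ 2)) = τ} := by
    refine card_le_card_of_injOn f (fun p hp => ?_) (fun p hp p' hp' h => ?_)
    · refine mem_filter.2 ⟨Fintype.mem_piFinset.2 fun i => mem_range.2 ?_, ?_⟩
      · have h1 := abs_le.1 (hLcube p hp i)
        have h2 := hf p hp i
        simp only [v] at h2
        omega
      · rw [← hτ p hp, ← sum_add_distrib]
        refine sum_congr rfl fun i _ => ?_
        have h2 : p.2 i = ζ i - p.1 i := by rw [← hζ p hp, Pi.add_apply]; ring
        rw [hf p hp i, h2]
        ring
    · have h1 : p.1 = p'.1 := funext fun i => by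
        have h2 := hf p hp i
        rw [h, hf p' hp' i] at h2
        omega
      have h2 : p.1 + p.2 = p'.1 + p'.2 := by rw [hζ p hp, hζ p' hp']
      rw [h1] at h2
      exact Prod.ext h1 (add_left_cancel h2)
  calc (#s : ℝ) ≤ C * ((2 * L + 1 : ℕ) : ℝ) ^ (n - 2) :=
        (Nat.cast_le.2 hle).trans (hcard _ (by omega) _ _ τ)
    _ ≤ C * (3 * N) ^ (n - 2) := by
        gcongr
        push_cast
        linarith
    _ = _ := by rw [mul_pow]; ring

theorem tWave_mul_tWave (n : ℕ) (a₁ a₂ : (Fin n → ℤ) →₀ ℂ) (t : ℝ) (x : Fin n → ℝ) :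
    tWave n a₁ t x * tWave n a₂ t x = ∑ p ∈ a₁.support ×ˢ a₂.support, a₁ p.1 * a₂ p.2 *
      Complex.exp (((∑ i, x i * (((p.1 + p.2) i : ℤ) : ℝ)) -
        t * (∑ i, p.1 i ^ 2 + ∑ i, p.2 i ^ 2 : ℤ) : ℝ) * Complex.I) := by
  rw [tWave, tWave, sum_mul_sum, sum_product]
  refine sum_congr rfl fun ξ _ => sum_congr rfl fun η _ => ?_
  rw [mul_mul_mul_comm, ← Complex.exp_add]
  congr 2
  simp only [Pi.add_apply, Int.cast_add, mul_add, sum_add_distrib]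
  push_cast
  ring

/-- bilinear estimate without decay for `n ≥ 5`, with the first factor
localized in an arbitrary cube `ξ₀ + [−N,N]ⁿ` of side length `2N`. -/
theorem bilinear_cube (n : ℕ) (hn : 5 ≤ n) :
    ∃ C > 0, ∀ N : ℝ, 1 ≤ N → ∀ ξ₀ : Fin n → ℤ,
      ∀ a₁ a₂ : (Fin n → ℤ) →₀ ℂ,
      (∀ ξ ∈ a₁.support, ∀ i, |(ξ i : ℝ) - (ξ₀ i : ℝ)| ≤ N) →
      (∀ ξ ∈ a₂.support, znorm n ξ ≤ 2 * N) →
      boxLpNorm n 2 (fun t x => tWave n a₁ t x * tWave n a₂ t x) ≤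
        C * N ^ ((n : ℝ) / 2 - 1) * l2Norm n a₁ * l2Norm n a₂ := by
  obtain ⟨C, hC, hcard⟩ := exists_card_resonance_le n hn
  refine ⟨√((2 * π) ^ (n + 1) * C), by positivity, fun N hN ξ₀ a₁ a₂ h₁ _ => ?_⟩
  have hN0 : 0 < N := by linarith
  set s := a₁.support ×ˢ a₂.support with hs
  have key := setIntegral_stBox_norm_sq_le s (fun p => a₁ p.1 * a₂ p.2) (fun p => p.1 + p.2)
    (fun p => ∑ i, p.1 i ^ 2 + ∑ i, p.2 i ^ 2) (D := C * N ^ (n - 2)) fun p _ => by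
      refine hcard N hN ξ₀ (p.1 + p.2) (∑ i, p.1 i ^ 2 + ∑ i, p.2 i ^ 2) _ (fun p' hp' => ?_)
        (fun p' hp' => (mem_filter.1 hp').2.1) (fun p' hp' => (mem_filter.1 hp').2.2)
      exact h₁ _ (mem_product.1 (mem_filter.1 hp').1).1
  have hnorm : ∑ p ∈ s, ‖a₁ p.1 * a₂ p.2‖ ^ 2 =
      (∑ ξ ∈ a₁.support, ‖a₁ ξ‖ ^ 2) * ∑ ξ ∈ a₂.support, ‖a₂ ξ‖ ^ 2 := by
    rw [hs, sum_mul_sum, sum_product]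
    simp_rw [norm_mul, mul_pow]
  have hpow : N ^ ((n : ℝ) / 2 - 1) = √(N ^ (n - 2)) := by
    rw [sqrt_eq_rpow, ← rpow_natCast, ← rpow_mul hN0.le, Nat.cast_sub (by omega)]
    congr 1
    push_cast
    ring
  rw [boxLpNorm, ← sqrt_eq_rpow, hpow, l2Norm, l2Norm, ← sqrt_mul (by positivity),
    ← sqrt_mul (by positivity), ← sqrt_mul (by positivity)]
  refine sqrt_le_sqrt ?_
  simp_rw [rpow_two, tWave_mul_tWave]
  rw [hnorm] at key
  refine key.trans (le_of_eq ?_)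
  ring
end
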